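/- As the real variable x tends to infinity, cos(π/(2x)) − cos(π/(2x) + δ₀(x)/2) − π⁵/(4x⁵) − 37π⁷/(96x⁷) = O(1/x⁸). -/

import Mathlib

open Real Filter Asymptotics

/-- `δ₀(x) = arctan(tan(2π/x)·tan(π/x)) − arcsin(sin(2π/x)·sin(π/x) / √(4·sin(π/x)² + cos(4π/x)))`. -/
noncomputable def δ₀ (x : ℝ) : ℝ :=
  Real.arctan (Real.tan (2 * π / x) * Real.tan (π / x)) -
    Real.arcsin (Real.sin (2 * π / x) * Real.sin (π / x) /
      Real.sqrt (4 * Real.sin (π / x) ^ 2 + Real.cos (4 * π / x)))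

theorem AnalyticAt.sub_linear_isBigO_sq {f : ℝ → ℝ} {f' : ℝ} (hf : AnalyticAt ℝ f 0)
    (hf' : HasDerivAt f f' 0) :
    (fun y => f y - (f 0 + f' * y)) =O[nhds 0] fun y => y ^ 2 := by
  obtain ⟨p, hp⟩ := hf
  have h := hp.isBigO_sub_partialSum_pow 2
  have hd : p.coeff 1 = f' := hp.hasDerivAt.unique hf'
  have h0 : p.coeff 0 = f 0 := hp.coeff_zero _
  simp only [zero_add, FormalMultilinearSeries.partialSum, Finset.sum_range_succ,
    Finset.sum_range_zero, FormalMultilinearSeries.apply_eq_pow_smul_coeff, hd, h0,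
    smul_eq_mul, pow_zero, one_mul, pow_one] at h
  refine (h.congr_left fun y => by ring).trans (.of_bound 1 ?_)
  simp

/-- The sine of the difference of the two angles, in closed form. -/
theorem sin_arctan_sub_arcsin {a b d : ℝ} (hb : 0 < b) (hd : a ^ 2 + b ^ 2 ≤ d) :
    sin (arctan (a / b) - arcsin (a / √d)) =
      a * (d - a ^ 2 - b ^ 2) / ((√(d - a ^ 2) + b) * √(a ^ 2 + b ^ 2) * √d) := by
  have hd0 : 0 < d := by nlinarith [sq_nonneg a, pow_pos hb 2]
  have hs : 0 < √d := sqrt_pos.2 hd0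
  have hab : 0 < √(a ^ 2 + b ^ 2) := sqrt_pos.2 (by positivity)
  have habs : |a / √d| ≤ 1 := by
    rw [abs_div, abs_of_pos hs, div_le_one hs]
    exact abs_le_sqrt (by nlinarith)
  have h1 : √(1 + (a / b) ^ 2) = √(a ^ 2 + b ^ 2) / b := by
    rw [← sqrt_sq hb.le, ← sqrt_div' _ (by positivity), sqrt_sq hb.le]
    congr 1
    field_simp
    ring
  have h2 : √(1 - (a / √d) ^ 2) = √(d - a ^ 2) / √d := by
    rw [← sqrt_div' _ hd0.le, div_pow, sq_sqrt hd0.le]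
    congr 1
    field_simp
  rw [sin_sub, sin_arctan, cos_arctan, cos_arcsin,
    sin_arcsin (abs_le.1 habs).1 (abs_le.1 habs).2, h1, h2]
  have hq : √(d - a ^ 2) ^ 2 = d - a ^ 2 := sq_sqrt (by nlinarith [sq_nonneg b])
  rw [show a * (d - a ^ 2 - b ^ 2) = a * (√(d - a ^ 2) ^ 2 - b ^ 2) by rw [hq]]
  field_simp
  ring

theorem abs_arctan_sub_arcsin_le {a b d : ℝ} (ha : 0 ≤ a) (hb : 0 < b) :
    |arctan (a / b) - arcsin (a / √d)| ≤ π / 2 := by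
  have h1 : 0 ≤ arctan (a / b) := arctan_nonneg.2 (by positivity)
  have h2 := arctan_lt_pi_div_two (a / b)
  have h3 : 0 ≤ arcsin (a / √d) := arcsin_nonneg.2 (by positivity)
  have h4 := arcsin_le_pi_div_two (a / √d)
  rw [abs_le]
  constructor <;> linarith

/-- The smooth factor of `sin δ₀`, as a function of `1 - cos (2 * π / x)`. -/
noncomputable def gapFactor (e : ℝ) : ℝ :=
  (1 / 2 - e + e ^ 2) * √(1 - e / 2) /
    ((√(1 - 2 * e + 2 * e ^ 2 - e ^ 2 * (1 - e / 2)) + (1 - e) * √(1 - e / 2)) *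
      √(e ^ 2 * (1 - e / 2) + (1 - e) ^ 2 * (1 - e / 2)) * √(1 - 2 * e + 2 * e ^ 2))

theorem gapFactor_sub_isBigO :
    (fun e => gapFactor e - (1 / 4 + 9 / 32 * e)) =O[nhds 0] fun e => e ^ 2 := by
  have h0 : gapFactor 0 = 1 / 4 := by norm_num [gapFactor]
  have hA : AnalyticAt ℝ gapFactor 0 := by
    refine ContDiffAt.analyticAt ?_
    unfold gapFactor
    refine ContDiffAt.div ?_ ?_ (by norm_num) <;>
    fun_prop (disch := norm_num)
  have hd : HasDerivAt gapFactor (9 / 32) 0 := by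
    have k {f : ℝ → ℝ} {f' : ℝ} (h : HasDerivAt f f' 0) (h1 : f 0 = 1) :
        HasDerivAt (fun e => √(f e)) (f' / 2) 0 := by
      simpa [h1] using h.sqrt (by simp [h1])
    have hi := hasDerivAt_id (0 : ℝ)
    have s1 := k ((hi.div_const 2).const_sub 1) (by norm_num)
    have s2 := k ((((hi.const_mul 2).const_sub 1).add ((hi.pow 2).const_mul 2)).sub
      ((hi.pow 2).mul ((hi.div_const 2).const_sub 1))) (by norm_num)
    have s3 := k (((hi.pow 2).mul ((hi.div_const 2).const_sub 1)).add
      (((hi.const_sub 1).pow 2).mul ((hi.div_const 2).const_sub 1))) (by norm_num)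
    have s4 := k (((hi.const_mul 2).const_sub 1).add ((hi.pow 2).const_mul 2)) (by norm_num)
    have H := ((((hi.const_sub (1 / 2)).add (hi.pow 2)).mul s1).div
      (((s2.add ((hi.const_sub 1).mul s1)).mul s3).mul s4) (by norm_num))
    refine H.congr_deriv ?_
    norm_num
  simpa [h0] using hA.sub_linear_isBigO_sq hd

/-- The angle `δ₀` as a function of `h = π / x`. -/
noncomputable def gapAngle (h : ℝ) : ℝ :=
  arctan (tan (2 * h) * tan h) -
    arcsin (sin (2 * h) * sin h / √(4 * sin h ^ 2 + cos (4 * h)))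

theorem δ₀_eq_gapAngle (x : ℝ) : δ₀ x = gapAngle (π / x) := by
  simp only [δ₀, gapAngle, mul_div_assoc]

theorem tan_two_mul_mul_tan (h : ℝ) :
    tan (2 * h) * tan h = sin (2 * h) * sin h / (cos (2 * h) * cos h) := by
  rw [tan_eq_sin_div_cos, tan_eq_sin_div_cos, div_mul_div_comm]

theorem sin_gapAngle {h : ℝ} (hc : 0 < cos h) (hs : sin h ^ 2 < 1 / 2) :
    sin (gapAngle h) = (2 * sin h ^ 2) ^ 2 * gapFactor (2 * sin h ^ 2) := by
  have hc2 : cos (2 * h) = 1 - 2 * sin h ^ 2 := by rw [cos_two_mul, cos_sq']; ring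
  have hc4 : cos (4 * h) = 2 * (1 - 2 * sin h ^ 2) ^ 2 - 1 := by
    rw [show 4 * h = 2 * (2 * h) by ring, cos_two_mul, hc2]
  have hsq : cos h ^ 2 = 1 - sin h ^ 2 := cos_sq' h
  have hroot : √(1 - 2 * sin h ^ 2 / 2) = cos h := by
    rw [← sqrt_sq hc.le, hsq]; congr 1; ring
  have hb : 0 < cos (2 * h) * cos h := mul_pos (by rw [hc2]; linarith) hc
  have ha2 : (sin (2 * h) * sin h) ^ 2 = (2 * sin h ^ 2) ^ 2 * (1 - 2 * sin h ^ 2 / 2) := by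
    rw [sin_two_mul]; linear_combination 4 * sin h ^ 4 * hsq
  have hb2 : (cos (2 * h) * cos h) ^ 2 =
      (1 - 2 * sin h ^ 2) ^ 2 * (1 - 2 * sin h ^ 2 / 2) := by
    rw [hc2]; linear_combination (1 - 2 * sin h ^ 2) ^ 2 * hsq
  have hd : 4 * sin h ^ 2 + cos (4 * h) = 1 - 2 * (2 * sin h ^ 2) + 2 * (2 * sin h ^ 2) ^ 2 := by
    rw [hc4]; ring
  rw [gapAngle, tan_two_mul_mul_tan, sin_arctan_sub_arcsin hb, ha2, hb2, hd, gapFactor, hroot,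
    hc2, sin_two_mul]
  · ring
  · rw [ha2, hb2, hd]
    nlinarith [mul_nonneg (sq_nonneg (sin h)) (sq_nonneg (1 - 4 * sin h ^ 2)), sq_nonneg (sin h),
      mul_nonneg (sq_nonneg (sin h)) (sq_nonneg (sin h))]

theorem abs_gapAngle_le {h : ℝ} (hc : 0 < cos h) (hs : sin h ^ 2 < 1 / 2) :
    |gapAngle h| ≤ π / 2 := by
  have hc2 : 0 < cos (2 * h) := by rw [cos_two_mul, cos_sq']; linarith
  rw [gapAngle, tan_two_mul_mul_tan]
  refine abs_arctan_sub_arcsin_le ?_ (mul_pos hc2 hc)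
  rw [sin_two_mul]
  nlinarith [mul_nonneg (sq_nonneg (sin h)) hc.le]

theorem eventually_cos_pos_and_sin_sq_lt :
    ∀ᶠ h in nhds (0 : ℝ), 0 < cos h ∧ sin h ^ 2 < 1 / 2 :=
  (continuous_cos.continuousAt.eventually (lt_mem_nhds (by norm_num))).and
    ((continuous_sin.pow 2).continuousAt.eventually (gt_mem_nhds (by norm_num)))

theorem sin_sub_isBigO :
    (fun h : ℝ => sin h - (h - h ^ 3 / 6)) =O[nhds 0] fun h => h ^ 5 := by
  refine .of_bound (1 / 100) ?_
  filter_upwards [Metric.closedBall_mem_nhds (0 : ℝ) one_pos] with h hh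
  have := sin_bound (x := h) (by simpa using hh)
  simpa [div_eq_inv_mul] using this

theorem pow_isBigO_pow_nhds_zero {m n : ℕ} (hmn : m ≤ n) :
    (fun h : ℝ => h ^ n) =O[nhds 0] fun h => h ^ m := by
  refine .of_bound 1 ?_
  filter_upwards [Metric.closedBall_mem_nhds (0 : ℝ) one_pos] with h hh
  rw [one_mul, norm_pow, norm_pow]
  exact pow_le_pow_of_le_one (norm_nonneg h) (by simpa using hh) hmn

theorem sin_isBigO_pow_one : (fun h : ℝ => sin h) =O[nhds 0] fun h => h ^ 1 :=
  .of_bound 1 <| .of_forall fun h => by simpa using abs_sin_le_abs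

theorem monomial_isBigO {m n : ℕ} (c : ℝ) (hmn : m ≤ n) :
    (fun h : ℝ => c * h ^ n) =O[nhds 0] fun h => h ^ m :=
  (pow_isBigO_pow_nhds_zero hmn).const_mul_left c

theorem Asymptotics.IsBigO.mul_pow {f g : ℝ → ℝ} {l : Filter ℝ} {m n : ℕ}
    (hf : f =O[l] fun h => h ^ m) (hg : g =O[l] fun h => h ^ n) :
    (fun h => f h * g h) =O[l] fun h => h ^ (m + n) := by
  simpa only [pow_add] using hf.mul hg

theorem two_mul_sin_sq_sub_isBigO :
    (fun h : ℝ => 2 * sin h ^ 2 - (2 * h ^ 2 - 2 / 3 * h ^ 4)) =O[nhds 0] fun h => h ^ 6 := by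
  have h1 : (fun h : ℝ => h - h ^ 3 / 6) =O[nhds 0] fun h => h ^ 1 := by
    refine ((monomial_isBigO 1 le_rfl).sub (monomial_isBigO (m := 1) (n := 3) (1 / 6)
      (by norm_num))).congr_left fun h => by ring
  have h2 := (sin_sub_isBigO.mul_pow (sin_isBigO_pow_one.add h1)).const_mul_left 2
  exact (h2.add (monomial_isBigO (1 / 18) le_rfl)).congr_left fun h => by ring

theorem two_mul_sin_sq_isBigO : (fun h : ℝ => 2 * sin h ^ 2) =O[nhds 0] fun h => h ^ 2 :=
  ((sin_isBigO_pow_one.mul_pow sin_isBigO_pow_one).const_mul_left 2).congr_left fun h => by ring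

theorem sin_gapAngle_sub_isBigO :
    (fun h => sin (gapAngle h) - (h ^ 4 + 19 / 12 * h ^ 6)) =O[nhds 0] fun h => h ^ 8 := by
  have hlim : Tendsto (fun h : ℝ => 2 * sin h ^ 2) (nhds 0) (nhds 0) := by
    have : Continuous fun h : ℝ => 2 * sin h ^ 2 := by fun_prop
    simpa using this.tendsto 0
  have he := two_mul_sin_sq_isBigO
  have he2 := he.mul_pow he
  have hg : (fun h => gapFactor (2 * sin h ^ 2) - (1 / 4 + 9 / 32 * (2 * sin h ^ 2))) =O[nhds 0]
      fun h => h ^ 4 :=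
    (gapFactor_sub_isBigO.comp_tendsto hlim).trans (he2.congr_left fun h => by simp; ring)
  have hp : (fun h : ℝ => 2 * h ^ 2 - 2 / 3 * h ^ 4) =O[nhds 0] fun h => h ^ 2 :=
    (monomial_isBigO 2 le_rfl).sub (monomial_isBigO (2 / 3) (by norm_num))
  have hdiff := two_mul_sin_sq_sub_isBigO
  have hsq := hdiff.mul_pow (he.add hp)
  have hcube := hdiff.mul_pow ((he2.add (he.mul_pow hp)).add (hp.mul_pow hp))
  have hrest : (fun h : ℝ => (1 / 4 * (2 * h ^ 2 - 2 / 3 * h ^ 4) ^ 2 +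
      9 / 32 * (2 * h ^ 2 - 2 / 3 * h ^ 4) ^ 3) - (h ^ 4 + 19 / 12 * h ^ 6)) =O[nhds 0]
      fun h => h ^ 8 :=
    (((monomial_isBigO (-77 / 36) le_rfl).add (monomial_isBigO (3 / 4) (by norm_num : 8 ≤ 10))).add
      (monomial_isBigO (-1 / 12) (by norm_num : 8 ≤ 12))).congr_left fun h => by ring
  have hmain := (((he2.mul_pow hg).add (hsq.const_mul_left (1 / 4))).add
    ((hcube.const_mul_left (9 / 32)).trans (pow_isBigO_pow_nhds_zero (by norm_num)))).add hrest
  refine hmain.congr' ?_ .rfl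
  filter_upwards [eventually_cos_pos_and_sin_sq_lt] with h hh
  rw [sin_gapAngle hh.1 hh.2]
  ring

theorem gapAngle_isBigO : gapAngle =O[nhds 0] fun h => h ^ 4 := by
  have hs : (fun h => sin (gapAngle h)) =O[nhds 0] fun h => h ^ 4 :=
    ((sin_gapAngle_sub_isBigO.trans (pow_isBigO_pow_nhds_zero (by norm_num))).add
      ((monomial_isBigO 1 le_rfl).add (monomial_isBigO (19 / 12) (by norm_num : 4 ≤ 6)))).congr_left
      fun h => by ring
  refine IsBigO.trans (.of_bound (π / 2) ?_) hs
  filter_upwards [eventually_cos_pos_and_sin_sq_lt] with h hh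
  have := mul_abs_le_abs_sin (abs_gapAngle_le hh.1 hh.2)
  rw [norm_eq_abs, norm_eq_abs]
  calc |gapAngle h| = π / 2 * (2 / π * |gapAngle h|) := by field_simp
    _ ≤ _ := by gcongr

theorem sin_gapAngle_half_sub_isBigO :
    (fun h => sin (gapAngle h / 2) - (1 / 2 * h ^ 4 + 19 / 24 * h ^ 6)) =O[nhds 0]
      fun h => h ^ 8 := by
  have hlim : Tendsto gapAngle (nhds 0) (nhds 0) :=
    gapAngle_isBigO.trans_tendsto (by simpa using (continuous_pow 4).tendsto (0 : ℝ))
  have hcube : (fun y : ℝ => sin y - y) =O[nhds 0] fun y => y ^ 3 :=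
    ((sin_sub_isBigO.trans (pow_isBigO_pow_nhds_zero (by norm_num))).sub
      (monomial_isBigO (1 / 6) le_rfl)).congr_left fun y => by ring
  have hd3 : (fun h => gapAngle h ^ 3) =O[nhds 0] fun h => h ^ 8 :=
    (gapAngle_isBigO.pow 3).trans
      ((pow_isBigO_pow_nhds_zero (by norm_num : 8 ≤ 12)).congr_left fun h => by ring)
  have h1 := (hcube.comp_tendsto hlim).trans hd3
  have hlim2 : Tendsto (fun h => gapAngle h / 2) (nhds 0) (nhds 0) := by
    simpa using hlim.div_const 2
  have h2 := (hcube.comp_tendsto hlim2).trans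
    ((hd3.const_mul_left (1 / 8)).congr_left fun h => by simp; ring)
  refine ((h2.sub (h1.const_mul_left (1 / 2))).add
    (sin_gapAngle_sub_isBigO.const_mul_left (1 / 2))).congr_left fun h => ?_
  simp only [Function.comp_apply]
  ring

theorem one_sub_cos_gapAngle_half_isBigO :
    (fun h => 1 - cos (gapAngle h / 2)) =O[nhds 0] fun h => h ^ 8 := by
  have hd2 : (fun h => gapAngle h ^ 2) =O[nhds 0] fun h => h ^ 8 :=
    (gapAngle_isBigO.mul_pow gapAngle_isBigO).congr_left fun h => by ring
  refine IsBigO.trans (.of_bound 1 <| .of_forall fun h => ?_) hd2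
  have h1 := one_sub_sq_div_two_le_cos (x := gapAngle h / 2)
  have h2 := cos_le_one (gapAngle h / 2)
  rw [norm_of_nonneg (by linarith), norm_of_nonneg (sq_nonneg _)]
  nlinarith [sq_nonneg (gapAngle h)]

theorem cos_sub_cos_gapAngle_isBigO :
    (fun h => cos (h / 2) - cos (h / 2 + gapAngle h / 2) - h ^ 5 / 4 - 37 * h ^ 7 / 96) =O[nhds 0]
      fun h => h ^ 8 := by
  have hlim : Tendsto (fun h : ℝ => h / 2) (nhds 0) (nhds 0) := by
    simpa using (continuous_id.div_const (2 : ℝ)).tendsto 0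
  have hs : (fun h : ℝ => sin (h / 2) - (1 / 2 * h - 1 / 48 * h ^ 3)) =O[nhds 0]
      fun h => h ^ 4 :=
    ((sin_sub_isBigO.comp_tendsto hlim).trans ((monomial_isBigO (1 / 32)
      (by norm_num : 4 ≤ 5)).congr_left fun h => by simp; ring)).congr_left
      fun h => by simp only [Function.comp_apply]; ring
  have hsin : (fun h : ℝ => sin (h / 2)) =O[nhds 0] fun h => h ^ 0 :=
    .of_bound 1 <| .of_forall fun h => by simpa using abs_sin_le_one (h / 2)
  have hcos : (fun h : ℝ => cos (h / 2)) =O[nhds 0] fun h => h ^ 0 :=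
    .of_bound 1 <| .of_forall fun h => by simpa using abs_cos_le_one (h / 2)
  have hq : (fun h : ℝ => 1 / 2 * h ^ 4 + 19 / 24 * h ^ 6) =O[nhds 0] fun h => h ^ 4 :=
    (monomial_isBigO _ le_rfl).add (monomial_isBigO _ (by norm_num))
  have h1 := hcos.mul_pow one_sub_cos_gapAngle_half_isBigO
  have h2 := hsin.mul_pow sin_gapAngle_half_sub_isBigO
  have h3 := hs.mul_pow hq
  have h4 := monomial_isBigO (-19 / 1152) (by norm_num : 8 ≤ 9)
  refine (((h1.add h2).add h3).add h4).congr_left fun h => ?_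
  rw [cos_add]
  ring

theorem width_gap_Dn_isBigO' :
    (fun x : ℝ => Real.cos (π / (2 * x)) - Real.cos (π / (2 * x) + δ₀ x / 2)
        - π ^ 5 / (4 * x ^ 5) - 37 * π ^ 7 / (96 * x ^ 7))
      =O[atTop] (fun x : ℝ => 1 / x ^ 8) := by
  have hlim : Tendsto (fun x : ℝ => π / x) atTop (nhds 0) := tendsto_const_nhds.div_atTop tendsto_id
  have h := cos_sub_cos_gapAngle_isBigO.comp_tendsto hlim
  have hpow : ((fun h : ℝ => h ^ 8) ∘ fun x : ℝ => π / x) =O[atTop] fun x : ℝ => 1 / x ^ 8 :=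
    ((isBigO_refl (fun x : ℝ => 1 / x ^ 8) atTop).const_mul_left (π ^ 8)).congr_left
      fun x => by simp [div_eq_mul_inv, mul_pow]
  refine (h.trans hpow).congr_left fun x => ?_
  simp only [Function.comp_apply, ← δ₀_eq_gapAngle, div_pow]
  rw [show π / x / 2 = π / (2 * x) by rw [div_div, mul_comm]]
  ring
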